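/- Let q, z be complex numbers with q ≠ 0, z ≠ 0, and let m, n ≥ 1 be integers. Assume q^k ≠ 1 for all 1 ≤ k ≤ n, and z·q^{j-m} ≠ 1 for all 0 ≤ j ≤ m+n-2. Then ∑_{k=1}^{n} [n choose k]_q · (q^m/z;q)_k · (z/q;q)_{n-k} · z^k / ( (z·q^{-m};q)_{n+m-1} · (1-q^k)^m ) = ∑_{k_1=1}^{n} q^{k_1}/((1-z·q^{k_1-2})(1-q^{k_1})) · ∑_{k_2=1}^{k_1} q^{k_2}/((1-z·q^{k_2-3})(1-q^{k_2})) · ⋯ · ∑_{k_{m-1}=1}^{k_{m-2}} q^{k_{m-1}}/((1-z·q^{k_{m-1}-m})(1-q^{k_{m-1}})) · ( ∑_{k_m=1}^{k_{m-1}-1} z·q^{k_m-m}/(1 - z·q^{k_m-m}) − ∑_{k_m=1}^{k_{m-1}} q^{k_m}/(1 - q^{k_m}) ); that is, the right-hand side is the nested sum over 1 ≤ k_{m-1} ≤ ⋯ ≤ k_1 ≤ n of ∏_{i=1}^{m-1} q^{k_i}/((1-z·q^{k_i-i-1})(1-q^{k_i})) times the bracketed difference of sums with upper limits k_{m-1}-1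 and k_{m-1} (with the convention k_0 = n when m = 1). -/

import Mathlib

open Finset

/-- The q-Pochhammer symbol `(x;q)_N = ∏_{j=0}^{N-1} (1 - x q^j)`. -/
noncomputable def qPoch (q x : ℂ) (N : ℕ) : ℂ := ∏ j ∈ Finset.range N, (1 - x * q ^ j)

/-- The Gaussian binomial coefficient `[n choose k]_q = (q;q)_n / ((q;q)_k (q;q)_{n-k})`. -/
noncomputable def qBinom (q : ℂ) (n k : ℕ) : ℂ := qPoch q q n / (qPoch q q k * qPoch q q (n - k))

/-- `nestedSumB f g i r N` is the `r`-fold nested sum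
`∑_{k_1=1}^{N} f i k_1 ∑_{k_2=1}^{k_1} f (i+1) k_2 ⋯ ∑_{k_r=1}^{k_{r-1}} f (i+r-1) k_r · g k_r`,
with base value `g N` when `r = 0`. -/
noncomputable def nestedSumB (f : ℕ → ℕ → ℂ) (g : ℕ → ℂ) : ℕ → ℕ → ℕ → ℂ
  | _, 0, N => g N
  | i, r + 1, N => ∑ k ∈ Finset.Icc 1 N, f i k * nestedSumB f g (i + 1) r k

lemma qPoch_succ (q x : ℂ) (N : ℕ) : qPoch q x (N + 1) = qPoch q x N * (1 - x * q ^ N) :=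
  Finset.prod_range_succ _ _

lemma qPoch_zero (q x : ℂ) : qPoch q x 0 = 1 := Finset.prod_range_zero _

lemma qPoch_succ_left (q x : ℂ) (N : ℕ) :
    qPoch q x (N + 1) = (1 - x) * qPoch q (x * q) N := by
  unfold qPoch
  rw [Finset.prod_range_succ', mul_comm]
  simp [pow_succ', mul_assoc]

lemma qPoch_self_ne_zero {q : ℂ} {n : ℕ} (h : ∀ k : ℕ, 1 ≤ k → k ≤ n → q ^ k ≠ 1) :
    qPoch q q n ≠ 0 := by
  refine Finset.prod_ne_zero_iff.2 fun j hj => sub_ne_zero.2 fun e => ?_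
  refine h (j + 1) (by omega) (by have := Finset.mem_range.1 hj; omega) ?_
  rw [pow_succ', ← e]

lemma qBinom_zero_right {q : ℂ} {n : ℕ} (h : ∀ k : ℕ, 1 ≤ k → k ≤ n → q ^ k ≠ 1) :
    qBinom q n 0 = 1 := by
  simp [qBinom, qPoch_zero, qPoch_self_ne_zero h]

lemma qBinom_self {q : ℂ} {n : ℕ} (h : ∀ k : ℕ, 1 ≤ k → k ≤ n → q ^ k ≠ 1) :
    qBinom q n n = 1 := by
  simp [qBinom, qPoch_zero, qPoch_self_ne_zero h]

/-- The absorption identity relating `[k+d choose k]_q` and `[k+d+1 choose k]_q`. -/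
lemma qBinom_add_succ {q : ℂ} (k d : ℕ)
    (h : ∀ j : ℕ, 1 ≤ j → j ≤ k + d + 1 → q ^ j ≠ 1) :
    qBinom q (k + d) k
      = qBinom q (k + d + 1) k * (1 - q ^ (d + 1)) / (1 - q ^ (k + d + 1)) := by
  have h1 : (1 : ℂ) - q ^ (k + d + 1) ≠ 0 := sub_ne_zero.2 (h _ (by omega) le_rfl).symm
  have h2 : (1 : ℂ) - q ^ (d + 1) ≠ 0 := sub_ne_zero.2 (h _ (by omega) (by omega)).symm
  have hk : qPoch q q k ≠ 0 := qPoch_self_ne_zero fun j a b => h j a (by omega)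
  have hd : qPoch q q d ≠ 0 := qPoch_self_ne_zero fun j a b => h j a (by omega)
  have e1 : k + d + 1 - k = d + 1 := by omega
  have e2 : k + d - k = d := by omega
  rw [qBinom, qBinom, e1, e2, qPoch_succ, qPoch_succ, ← pow_succ', ← pow_succ']
  field_simp

lemma qBinom_pascal {q : ℂ} {n k : ℕ} (hk : k < n)
    (h : ∀ j : ℕ, 1 ≤ j → j ≤ n + 1 → q ^ j ≠ 1) :
    qBinom q (n + 1) (k + 1) = q ^ (k + 1) * qBinom q n (k + 1) + qBinom q n k := by
  obtain ⟨d, rfl⟩ := Nat.exists_eq_add_of_lt hk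
  have h1 : (1 : ℂ) - q ^ (k + 1) ≠ 0 := sub_ne_zero.2 (h _ (by omega) (by omega)).symm
  have h2 : (1 : ℂ) - q ^ (d + 1) ≠ 0 := sub_ne_zero.2 (h _ (by omega) (by omega)).symm
  have hk : qPoch q q k ≠ 0 := qPoch_self_ne_zero fun j a b => h j a (by omega)
  have hd : qPoch q q d ≠ 0 := qPoch_self_ne_zero fun j a b => h j a (by omega)
  have e1 : k + d + 1 + 1 - (k + 1) = d + 1 := by omega
  have e2 : k + d + 1 - (k + 1) = d := by omega
  have e3 : k + d + 1 - k = d + 1 := by omega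
  rw [qBinom, qBinom, qBinom, e1, e2, e3, qPoch_succ q q (k + d + 1), qPoch_succ q q k,
    qPoch_succ q q d, ← pow_succ', ← pow_succ', ← pow_succ']
  field_simp
  ring

/-- The `q`-Chu–Vandermonde identity in its `q`-binomial-convolution form. -/
lemma sum_qBinom_mul_qPoch_mul_qPoch (q a b : ℂ) (n : ℕ)
    (h : ∀ j : ℕ, 1 ≤ j → j ≤ n → q ^ j ≠ 1) :
    ∑ k ∈ Finset.range (n + 1), qBinom q n k * qPoch q a k * qPoch q b (n - k) * a ^ (n - k)
      = qPoch q (a * b) n := by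
  induction n with
  | zero => simp [qBinom, qPoch_zero]
  | succ n ih =>
    have h' : ∀ j : ℕ, 1 ≤ j → j ≤ n → q ^ j ≠ 1 := fun j a b => h j a (by omega)
    have key : ∑ k ∈ Finset.range (n + 1 + 1),
        qBinom q (n + 1) k * qPoch q a k * qPoch q b (n + 1 - k) * a ^ (n + 1 - k)
        = (∑ k ∈ Finset.range (n + 1),
            q ^ k * qBinom q n k * qPoch q a k * qPoch q b (n + 1 - k) * a ^ (n + 1 - k))
          + ∑ k ∈ Finset.range (n + 1),
            qBinom q n k * qPoch q a (k + 1) * qPoch q b (n - k) * a ^ (n - k) := by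
      rw [Finset.sum_range_succ', Finset.sum_range_succ, Finset.sum_range_succ',
        Finset.sum_range_succ (fun k => qBinom q n k * qPoch q a (k + 1) * _ * _),
        qBinom_zero_right h, qBinom_zero_right h', qBinom_self h, qBinom_self h']
      have : ∀ k ∈ Finset.range n,
          qBinom q (n + 1) (k + 1) * qPoch q a (k + 1) * qPoch q b (n + 1 - (k + 1))
              * a ^ (n + 1 - (k + 1))
            = q ^ (k + 1) * qBinom q n (k + 1) * qPoch q a (k + 1)
                * qPoch q b (n + 1 - (k + 1)) * a ^ (n + 1 - (k + 1))
              + qBinom q n k * qPoch q a (k + 1) * qPoch q b (n - k) * a ^ (n - k) := by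
        intro k hk
        rw [qBinom_pascal (Finset.mem_range.1 hk) h, Nat.add_sub_add_right]
        ring
      rw [Finset.sum_congr rfl this, Finset.sum_add_distrib]
      simp only [Nat.sub_self, pow_zero, Nat.add_sub_add_right]
      ring
    rw [key, ← Finset.sum_add_distrib, qPoch_succ, ← ih h', Finset.sum_mul]
    refine Finset.sum_congr rfl fun k hk => ?_
    obtain ⟨d, rfl⟩ := Nat.exists_eq_add_of_le (Nat.lt_succ_iff.1 (Finset.mem_range.1 hk))
    have e1 : k + d + 1 - k = d + 1 := by omega
    have e2 : k + d - k = d := by omega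
    rw [e1, e2, qPoch_succ, qPoch_succ]
    ring

/-- The sum on the left-hand side of the main identity. -/
noncomputable def qBinomSum (q z : ℂ) (m n : ℕ) : ℂ :=
  ∑ k ∈ Finset.Icc 1 n,
    qBinom q n k * qPoch q (q ^ m / z) k * qPoch q (z / q) (n - k) * z ^ k
      / (qPoch q (z * q ^ (-(m : ℤ))) (n + m - 1) * (1 - q ^ k) ^ m)

lemma qBinomSum_succ_succ {q z : ℂ} (hq : q ≠ 0) (m n : ℕ)
    (h : ∀ j : ℕ, 1 ≤ j → j ≤ n + 1 → q ^ j ≠ 1) (hzn : 1 - z / q * q ^ n ≠ 0) :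
    qBinomSum q z (m + 1) (n + 1) = qBinomSum q z (m + 1) n
      + q ^ (n + 1) / ((1 - z / q * q ^ n) * (1 - q ^ (n + 1)))
        * qBinomSum q (z / q) m (n + 1) := by
  have hN : (1 : ℂ) - q ^ (n + 1) ≠ 0 := sub_ne_zero.2 (h _ (by omega) le_rfl).symm
  have ea : q ^ m / (z / q) = q ^ (m + 1) / z := by rw [div_div_eq_mul_div, pow_succ]
  have ed : z / q * q ^ (-(m : ℤ)) = z * q ^ (-((m + 1 : ℕ) : ℤ)) := by
    rw [Nat.cast_succ, neg_add, zpow_add₀ hq, zpow_neg_one]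
    ring
  have el : z * q ^ (-((m + 1 : ℕ) : ℤ)) * q ^ (n + m) = z / q * q ^ n := by
    rw [← ed, pow_add, zpow_neg, zpow_natCast]
    field_simp
  have e1 : n + 1 + (m + 1) - 1 = n + m + 1 := by omega
  have e2 : n + (m + 1) - 1 = n + m := by omega
  have e3 : n + 1 + m - 1 = n + m := by omega
  unfold qBinomSum
  rw [e1, e2, e3, ea, ed, qPoch_succ q (z * _) (n + m), el]
  generalize qPoch q (z * q ^ (-((m + 1 : ℕ) : ℤ))) (n + m) = D
  obtain ⟨u, rfl⟩ : ∃ u, z = u * q := ⟨z / q, by field_simp⟩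
  simp only [mul_div_cancel_right₀ u hq] at hzn ⊢
  rw [Finset.sum_Icc_succ_top (by omega), Finset.sum_Icc_succ_top (by omega), mul_add,
    Finset.mul_sum, ← add_assoc, ← Finset.sum_add_distrib, Nat.sub_self, qPoch_zero, qPoch_zero]
  congr 1
  · refine Finset.sum_congr rfl fun k hk => ?_
    obtain ⟨hk1, hkn⟩ := Finset.mem_Icc.1 hk
    have hK : (1 : ℂ) - q ^ k ≠ 0 := sub_ne_zero.2 (h _ hk1 (by omega)).symm
    obtain ⟨d, rfl⟩ := Nat.exists_eq_add_of_le hkn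
    have f1 : k + d + 1 - k = d + 1 := by omega
    have f2 : k + d - k = d := by omega
    rw [f1, f2, qPoch_succ, qPoch_succ_left, div_mul_cancel₀ u hq, qBinom_add_succ k d h]
    generalize qBinom q (k + d + 1) k = B
    generalize qPoch q (q ^ (m + 1) / (u * q)) k = P
    generalize qPoch q u d = U
    rcases eq_or_ne D 0 with rfl | hD
    · simp
    field_simp
    ring
  · rcases eq_or_ne D 0 with rfl | hD
    · simp
    field_simp
    ring

lemma qBinomSum_zero_one {q z : ℂ} (hz : z ≠ 0) (h : q ≠ 1) : qBinomSum q z 0 1 = z - 1 := by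
  have h' : (1 : ℂ) - q ≠ 0 := sub_ne_zero.2 h.symm
  simp [qBinomSum, qBinom, qPoch, h']
  field_simp

lemma qBinomSum_zero_add_two {q z : ℂ} (hq : q ≠ 0) (hz : z ≠ 0) (n : ℕ)
    (h : ∀ j : ℕ, 1 ≤ j → j ≤ n + 2 → q ^ j ≠ 1) (hzn : qPoch q z (n + 1) ≠ 0) :
    qBinomSum q z 0 (n + 2) = z / q - 1 := by
  have V := sum_qBinom_mul_qPoch_mul_qPoch q z⁻¹ (z / q) (n + 2) h
  have hab : z⁻¹ * (z / q) = q⁻¹ := by field_simp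
  have hv : qPoch q (z⁻¹ * (z / q)) (n + 2) = 0 := by
    rw [hab, qPoch_succ_left, inv_mul_cancel₀ hq, qPoch_succ_left]
    simp
  rw [hv, Finset.range_eq_Ico, Finset.sum_eq_sum_Ico_succ_bot (by omega),
    qBinom_zero_right h, qPoch_zero, Nat.sub_zero, qPoch_succ_left q (z / q) (n + 1),
    div_mul_cancel₀ z hq] at V
  have hsum : qBinomSum q z 0 (n + 2) = z ^ (n + 2) / qPoch q z (n + 1)
      * ∑ k ∈ Finset.Ico (0 + 1) (n + 2 + 1), qBinom q (n + 2) k * qPoch q z⁻¹ k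
          * qPoch q (z / q) (n + 2 - k) * z⁻¹ ^ (n + 2 - k) := by
    rw [Finset.mul_sum]
    refine Finset.sum_congr (by ext; simp) fun k hk => ?_
    have hk' : k ≤ n + 2 := by have := Finset.mem_Ico.1 hk; omega
    have hp : z ^ (n + 2) = z ^ k * z ^ (n + 2 - k) := by
      rw [← pow_add, Nat.add_sub_cancel' hk']
    have e : n + 2 + 0 - 1 = n + 1 := by omega
    rw [hp, inv_pow, e]
    simp only [pow_zero, Nat.cast_zero, neg_zero, zpow_zero, mul_one, one_div]
    field_simp
  rw [hsum, eq_neg_of_add_eq_zero_right V, inv_pow]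
  field_simp
  ring

lemma qBinomSum_one {q z : ℂ} (hq : q ≠ 0) (hz : z ≠ 0) (n : ℕ)
    (h : ∀ j : ℕ, 1 ≤ j → j ≤ n → q ^ j ≠ 1)
    (hzj : ∀ j : ℕ, j < n → z / q * q ^ j ≠ 1) :
    qBinomSum q z 1 n = (∑ k ∈ Finset.Icc 1 (n - 1),
        z * q ^ ((k : ℤ) - 1) / (1 - z * q ^ ((k : ℤ) - 1)))
      - ∑ k ∈ Finset.Icc 1 n, q ^ k / (1 - q ^ k) := by
  induction n with
  | zero => simp [qBinomSum]
  | succ n ih =>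
    have hzn : 1 - z / q * q ^ n ≠ 0 := sub_ne_zero.2 (hzj n (by omega)).symm
    have hN : (1 : ℂ) - q ^ (n + 1) ≠ 0 := sub_ne_zero.2 (h _ (by omega) le_rfl).symm
    rw [qBinomSum_succ_succ hq 0 n h hzn,
      ih (fun j a b => h j a (by omega)) (fun j a => hzj j (by omega))]
    have hu : z / q ≠ 0 := div_ne_zero hz hq
    rcases n with _ | n
    · rw [qBinomSum_zero_one hu (by simpa using h 1 le_rfl le_rfl)]
      simp only [zero_add, pow_zero, mul_one, pow_one] at hzn hN ⊢
      simp only [Nat.zero_sub, Nat.sub_self, Finset.Icc_self, Finset.sum_singleton, pow_one,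
        Finset.Icc_eq_empty_of_lt zero_lt_one, Finset.sum_empty]
      generalize z / q = u at hzn
      field_simp
      ring
    · have hP : qPoch q (z / q) (n + 1) ≠ 0 :=
        Finset.prod_ne_zero_iff.2 fun j hj =>
          sub_ne_zero.2 (hzj j (by have := Finset.mem_range.1 hj; omega)).symm
      have hexp : z * q ^ (((n + 1 : ℕ) : ℤ) - 1) = z / q * q ^ (n + 1) := by
        rw [zpow_sub_one₀ hq, zpow_natCast]
        ring
      rw [qBinomSum_zero_add_two hq hu n h hP, Nat.add_sub_cancel, Nat.add_sub_cancel,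
        Finset.sum_Icc_succ_top (a := 1) (b := n) (by omega) (fun k : ℕ => z * q ^ ((k : ℤ) - 1) / _),
        Finset.sum_Icc_succ_top (b := n + 1) (by omega), hexp]
      obtain ⟨v, rfl⟩ : ∃ v, z = v * q := ⟨z / q, by field_simp⟩
      rw [mul_div_cancel_right₀ v hq] at hzn ⊢
      have hterm : q ^ (n + 1 + 1) / ((1 - v * q ^ (n + 1)) * (1 - q ^ (n + 1 + 1)))
          * (v / q - 1) = v * q ^ (n + 1) / (1 - v * q ^ (n + 1))
            - q ^ (n + 1 + 1) / (1 - q ^ (n + 1 + 1)) := by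
        rw [div_sub_div _ _ hzn hN, div_mul_eq_mul_div]
        congr 1
        field_simp
        ring
      rw [hterm]
      ring

lemma nestedSumB_succ_index (f : ℕ → ℕ → ℂ) (g : ℕ → ℂ) (i r N : ℕ) :
    nestedSumB f g (i + 1) r N = nestedSumB (fun i => f (i + 1)) g i r N := by
  induction r generalizing i N with
  | zero => rfl
  | succ r ih => simp only [nestedSumB, ih]

lemma qBinomSum_eq_nestedSumB {q : ℂ} (hq : q ≠ 0) (m : ℕ) : ∀ (z : ℂ) (n : ℕ), z ≠ 0 →
    (∀ k : ℕ, 1 ≤ k → k ≤ n → q ^ k ≠ 1) →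
    (∀ j : ℕ, j < m + n → z * q ^ ((j : ℤ) - ((m + 1 : ℕ) : ℤ)) ≠ 1) →
    qBinomSum q z (m + 1) n = nestedSumB
      (fun i k => q ^ k / ((1 - z * q ^ ((k : ℤ) - (i : ℤ) - 1)) * (1 - q ^ k)))
      (fun N =>
        (∑ k ∈ Finset.Icc 1 (N - 1), z * q ^ ((k : ℤ) - ((m + 1 : ℕ) : ℤ))
            / (1 - z * q ^ ((k : ℤ) - ((m + 1 : ℕ) : ℤ))))
          - ∑ k ∈ Finset.Icc 1 N, q ^ k / (1 - q ^ k))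
      1 m n := by
  have shift (z : ℂ) (t : ℤ) : z / q * q ^ t = z * q ^ (t - 1) := by
    rw [zpow_sub_one₀ hq]
    ring
  induction m with
  | zero =>
    intro z n hz h hzj
    rw [qBinomSum_one hq hz n h fun j hj => ?_]
    · simp [nestedSumB]
    · have := hzj j (by omega)
      rw [← zpow_natCast, shift]
      simpa using this
  | succ m ih =>
    intro z n hz h hzj
    induction n with
    | zero => simp [qBinomSum, nestedSumB]
    | succ n ihn =>
      have hzn : 1 - z / q * q ^ n ≠ 0 := by
        refine sub_ne_zero.2 (Ne.symm ?_)
        have := hzj (m + 1 + n) (by omega)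
        rw [← zpow_natCast, shift]
        convert this using 3
        push_cast
        ring
      rw [qBinomSum_succ_succ hq (m + 1) n h hzn,
        ihn (fun j a b => h j a (by omega)) (fun j a => hzj j (by omega)),
        ih (z / q) (n + 1) (div_ne_zero hz hq) h fun j hj => ?_]
      · simp only [nestedSumB]
        rw [Finset.sum_Icc_succ_top (by omega), nestedSumB_succ_index _ _ 1]
        congr 2
        · rw [← zpow_natCast q n, shift]
          push_cast
          ring_nf
        · congr 1
          · funext i k
            rw [shift]
            push_cast
            ring_nf
          · funext N
            congr 1
            refine Finset.sum_congr rfl fun k _ => ?_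
            rw [shift]
            push_cast
            ring_nf
      · have := hzj j (by omega)
        rw [shift]
        convert this using 3
        push_cast
        ring

theorem stmt_10 (q z : ℂ) (hq : q ≠ 0) (hz : z ≠ 0) (m n : ℕ) (hm : 1 ≤ m) (hn : 1 ≤ n)
    (hq1 : ∀ k : ℕ, 1 ≤ k → k ≤ n → q ^ k ≠ 1)
    (hz1 : ∀ j : ℕ, j < m + n - 1 → z * q ^ ((j : ℤ) - (m : ℤ)) ≠ 1) :
    ∑ k ∈ Finset.Icc 1 n,
        qBinom q n k * qPoch q (q ^ m / z) k * qPoch q (z / q) (n - k) * z ^ k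
          / (qPoch q (z * q ^ (-(m : ℤ))) (n + m - 1) * (1 - q ^ k) ^ m)
      = nestedSumB
          (fun i k => q ^ k / ((1 - z * q ^ ((k : ℤ) - (i : ℤ) - 1)) * (1 - q ^ k)))
          (fun N =>
            (∑ k ∈ Finset.Icc 1 (N - 1),
                z * q ^ ((k : ℤ) - (m : ℤ)) / (1 - z * q ^ ((k : ℤ) - (m : ℤ))))
              - ∑ k ∈ Finset.Icc 1 N, q ^ k / (1 - q ^ k))
          1 (m - 1) n := by
  obtain ⟨m, rfl⟩ := Nat.exists_eq_add_of_le' hm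
  exact qBinomSum_eq_nestedSumB hq m z n hz hq1 fun j hj => hz1 j (by omega)
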